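/- Let R be a commutative Noetherian ring, a an ideal of R, and M a finitely generated R-module of finite dimension d. Then Att_R H^d_a(M) = { p ∈ Assh_R M : cd_R(a, R/p) = d }. -/

import Mathlib

/- Common definitions: local cohomology modules, cohomological dimension, module dimension,
secondary representations and attached primes. -/

open CategoryTheory TensorProduct

/-- The `i`-th local cohomology module `H^i_a(M)`, as a type with its `R`-module structure. -/
noncomputable def TopLC (R : Type) [CommRing R] (a : Ideal R) (i : ℕ)
    (M : Type) [AddCommGroup M] [Module R M] : Type :=
  ((localCohomology a i).obj (ModuleCat.of R M))

noncomputable instance (R : Type) [CommRing R] (a : Ideal R) (i : ℕ)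
    (M : Type) [AddCommGroup M] [Module R M] : AddCommGroup (TopLC R a i M) :=
  inferInstanceAs (AddCommGroup ((localCohomology a i).obj (ModuleCat.of R M)))

noncomputable instance (R : Type) [CommRing R] (a : Ideal R) (i : ℕ)
    (M : Type) [AddCommGroup M] [Module R M] : Module R (TopLC R a i M) :=
  inferInstanceAs (Module R ((localCohomology a i).obj (ModuleCat.of R M)))

/-- The cohomological dimension `cd_R(a, M) = sup { i | H^i_a(M) ≠ 0 }`,
with value `⊥` if all local cohomology modules vanish. -/
noncomputable def cohDim (R : Type) [CommRing R] (a : Ideal R)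
    (M : Type) [AddCommGroup M] [Module R M] : WithBot ℕ∞ :=
  sSup {n : WithBot ℕ∞ | ∃ i : ℕ, n = (i : ℕ) ∧ Nontrivial (TopLC R a i M)}

/-- The (Krull) dimension of a module, i.e. the Krull dimension of its support. -/
noncomputable def moduleDim (R : Type) [CommRing R]
    (M : Type) [AddCommGroup M] [Module R M] : WithBot ℕ∞ :=
  Order.krullDim (Module.support R M)

/-- `Assh_R M`: the associated primes `p` of `M` with `dim R/p = dim M`. -/
noncomputable def Assh (R : Type) [CommRing R]
    (M : Type) [AddCommGroup M] [Module R M] : Set (Ideal R) :=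
  { p | p ∈ associatedPrimes R M ∧ ringKrullDim (R ⧸ p) = moduleDim R M }

/-- A submodule `S` is secondary if `S ≠ 0` and every `r : R` acts on `S` either
surjectively or nilpotently. -/
def IsSecondarySub (R : Type) [CommRing R] {M : Type} [AddCommGroup M] [Module R M]
    (S : Submodule R M) : Prop :=
  S ≠ ⊥ ∧ ∀ r : R, (∀ m ∈ S, ∃ s ∈ S, r • s = m) ∨ (∃ n : ℕ, ∀ m ∈ S, r ^ n • m = 0)

/-- A module is representable if it is the (finite) sum of secondary submodules. -/
def IsRepresentable (R : Type) [CommRing R] (M : Type) [AddCommGroup M] [Module R M] : Prop :=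
  ∃ (n : ℕ) (S : Fin n → Submodule R M), (∀ i, IsSecondarySub R (S i)) ∧ (⨆ i, S i) = ⊤

/-- A minimal secondary representation: secondary submodules summing to the whole module,
with pairwise distinct attached primes, none contained in the sum of the others. -/
def IsMinimalRep (R : Type) [CommRing R] {M : Type} [AddCommGroup M] [Module R M]
    {n : ℕ} (S : Fin n → Submodule R M) : Prop :=
  (∀ i, IsSecondarySub R (S i)) ∧ (⨆ i, S i) = ⊤ ∧
    (Function.Injective fun i => (S i).annihilator.radical) ∧
    ∀ j, ¬ (S j ≤ ⨆ i ∈ ({j}ᶜ : Set (Fin n)), S i)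

/-- The attached primes of a module: the radicals of the annihilators of the terms of a
minimal secondary representation. -/
def AttachedPrimes (R : Type) [CommRing R] (M : Type) [AddCommGroup M] [Module R M] :
    Set (Ideal R) :=
  { p | ∃ (n : ℕ) (S : Fin n → Submodule R M), IsMinimalRep R S ∧
      ∃ i, p = (S i).annihilator.radical }

/-- `stab b N = ⟨b⟩N = ⋂ₙ bⁿN`. -/
def stab {R M : Type} [CommRing R] [AddCommGroup M] [Module R M]
    (b : Ideal R) (N : Submodule R M) : Submodule R M :=
  ⨅ n : ℕ, b ^ n • N

open Opposite

universe u

/-- The element `x` of `K.X i` represents the homology class `h`, for a chain complex in the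
opposite of a category of modules. -/
def HRep {R : Type u} [CommRing R] (K : ChainComplex (ModuleCat.{u} R)ᵒᵖ ℕ) (i : ℕ)
    (x : (K.X i).unop) (h : (K.homology i).unop) : Prop :=
  ∃ z : (K.opcycles i).unop, (K.pOpcycles i).unop.hom z = x ∧ (K.homologyι i).unop.hom z = h

namespace HRep
variable {R : Type u} [CommRing R] {K L : ChainComplex (ModuleCat.{u} R)ᵒᵖ ℕ} {i : ℕ}

lemma exists_rep (h : (K.homology i).unop) : ∃ x, HRep K i x h := by
  have : Function.Surjective (K.homologyι i).unop.hom :=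
    (ModuleCat.epi_iff_surjective _).1 inferInstance
  obtain ⟨z, hz⟩ := this h
  exact ⟨_, z, rfl, hz⟩

lemma p_injective : Function.Injective (K.pOpcycles i).unop.hom :=
  (ModuleCat.mono_iff_injective _).1 inferInstance

lemma add {x y : (K.X i).unop} {h k : (K.homology i).unop} (hx : HRep K i x h) (hy : HRep K i y k) :
    HRep K i (x + y) (h + k) := by
  obtain ⟨z, rfl, rfl⟩ := hx
  obtain ⟨w, rfl, rfl⟩ := hy
  exact ⟨z + w, map_add _ _ _, map_add _ _ _⟩

lemma smul {x : (K.X i).unop} {h : (K.homology i).unop} (r : R) (hx : HRep K i x h) :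
    HRep K i (r • x) (r • h) := by
  obtain ⟨z, rfl, rfl⟩ := hx
  exact ⟨r • z, map_smul _ _ _, map_smul _ _ _⟩

lemma exists_class_iff (x : (K.X i).unop) :
    (∃ h, HRep K i x h) ↔ (K.d (i + 1) i).unop.hom x = 0 := by
  have hex : (ShortComplex.mk (K.d (i + 1) i) (K.pOpcycles i) (K.d_pOpcycles _ _)).Exact :=
    ShortComplex.exact_of_g_is_cokernel _ (K.opcyclesIsCokernel (i + 1) i (by simp))
  have h2 := (ShortComplex.ShortExact.moduleCat_exact_iff_function_exact _).1 hex.unop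
  constructor
  · rintro ⟨h, z, rfl, -⟩
    exact (h2 _).2 ⟨z, rfl⟩
  · intro hx
    obtain ⟨z, hz⟩ := (h2 x).1 hx
    exact ⟨_, z, hz, rfl⟩

lemma zero_iff (x : (K.X i).unop) :
    HRep K i x 0 ↔ ∃ y, (K.d i (i - 1)).unop.hom y = x := by
  have hnext : (ComplexShape.down ℕ).next i = i - 1 := by
    rcases i with _ | i <;> simp
  have hex : (ShortComplex.mk (K.homologyι i) (K.fromOpcycles i (i - 1))
      (K.homologyι_comp_fromOpcycles _ _)).Exact :=
    ShortComplex.exact_of_f_is_kernel _ (K.homologyIsKernel i (i - 1) hnext)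
  have h2 := (ShortComplex.ShortExact.moduleCat_exact_iff_function_exact _).1 hex.unop
  have hd : ∀ y, (K.d i (i - 1)).unop.hom y =
      (K.pOpcycles i).unop.hom ((K.fromOpcycles i (i - 1)).unop.hom y) := by
    intro y
    rw [← K.p_fromOpcycles i (i - 1)]
    rfl
  constructor
  · rintro ⟨z, rfl, hz⟩
    obtain ⟨y, hy⟩ := (h2 z).1 hz
    exact ⟨y, (hd y).trans (congrArg _ hy)⟩
  · rintro ⟨y, rfl⟩
    exact ⟨(K.fromOpcycles i (i - 1)).unop.hom y, (hd y).symm, (h2 _).2 ⟨y, rfl⟩⟩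

lemma map (f : K ⟶ L) {x : (L.X i).unop} {h : (L.homology i).unop} (hx : HRep L i x h) :
    HRep K i ((f.f i).unop.hom x) ((HomologicalComplex.homologyMap f i).unop.hom h) := by
  obtain ⟨z, rfl, rfl⟩ := hx
  refine ⟨(HomologicalComplex.opcyclesMap f i).unop.hom z, ?_, ?_⟩
  · simp only [← LinearMap.comp_apply, ← ModuleCat.hom_comp, ← unop_comp]
    rw [HomologicalComplex.p_opcyclesMap]
  · simp only [← LinearMap.comp_apply, ← ModuleCat.hom_comp, ← unop_comp]
    rw [HomologicalComplex.homologyι_naturality]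

lemma unique {x : (K.X i).unop} {h k : (K.homology i).unop} (hx : HRep K i x h)
    (hy : HRep K i x k) : h = k := by
  obtain ⟨z, rfl, rfl⟩ := hx
  obtain ⟨w, hw, rfl⟩ := hy
  rw [p_injective hw]
end HRep


section
variable {R : Type u} [CommRing R]

/-- The cocycle `φ` represents the class `e` in `Ext`. -/
def ERep {X : ModuleCat.{u} R} (P : ProjectiveResolution X) (i : ℕ) {Y : ModuleCat.{u} R}
    (φ : P.complex.X i ⟶ Y) (e : ((Ext R (ModuleCat.{u} R) i).obj (op X)).obj Y) : Prop :=
  ∃ h, HRep ((((linearYoneda R (ModuleCat.{u} R)).obj Y).rightOp.mapHomologicalComplex _).obj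
    P.complex) i φ h ∧
    (P.isoLeftDerivedObj ((linearYoneda R (ModuleCat.{u} R)).obj Y).rightOp i).hom.unop.hom h = e

namespace ERep
variable {X X' : ModuleCat.{u} R} {P : ProjectiveResolution X} {P' : ProjectiveResolution X'}
  {i : ℕ} {Y Y' : ModuleCat.{u} R}

lemma exists_rep (P : ProjectiveResolution X) (e : ((Ext R (ModuleCat.{u} R) i).obj (op X)).obj Y) :
    ∃ φ, ERep P i φ e := by
  obtain ⟨φ, hφ⟩ := HRep.exists_rep
    ((P.isoLeftDerivedObj ((linearYoneda R (ModuleCat.{u} R)).obj Y).rightOp i).inv.unop.hom e)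
  refine ⟨φ, _, hφ, ?_⟩
  exact congrArg (fun t => t.unop.hom e)
    (P.isoLeftDerivedObj ((linearYoneda R (ModuleCat.{u} R)).obj Y).rightOp i).hom_inv_id

lemma add {φ ψ : P.complex.X i ⟶ Y} {e e'} (h : ERep P i φ e) (h' : ERep P i ψ e') :
    ERep P i (φ + ψ) (e + e') := by
  obtain ⟨x, hx, rfl⟩ := h
  obtain ⟨y, hy, rfl⟩ := h'
  exact ⟨x + y, hx.add hy, map_add _ _ _⟩

lemma smul {φ : P.complex.X i ⟶ Y} {e} (r : R) (h : ERep P i φ e) :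
    ERep P i (r • φ) (r • e) := by
  obtain ⟨x, hx, rfl⟩ := h
  exact ⟨r • x, hx.smul r, map_smul _ _ _⟩

lemma exists_class_iff (φ : P.complex.X i ⟶ Y) :
    (∃ e, ERep P i φ e) ↔ P.complex.d (i + 1) i ≫ φ = 0 := by
  refine Iff.trans ?_ (HRep.exists_class_iff (K := (((linearYoneda R
    (ModuleCat.{u} R)).obj Y).rightOp.mapHomologicalComplex _).obj P.complex) (i := i) φ)
  exact ⟨fun ⟨e, h, hh, _⟩ => ⟨h, hh⟩, fun ⟨h, hh⟩ => ⟨_, h, hh, rfl⟩⟩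

lemma zero_iff (φ : P.complex.X i ⟶ Y) :
    ERep P i φ 0 ↔ ∃ ψ, P.complex.d i (i - 1) ≫ ψ = φ := by
  refine Iff.trans ?_ (HRep.zero_iff (K := (((linearYoneda R
    (ModuleCat.{u} R)).obj Y).rightOp.mapHomologicalComplex _).obj P.complex) (i := i) φ)
  constructor
  · rintro ⟨h, hh, h0⟩
    have : h = 0 := by
      have := congrArg (P.isoLeftDerivedObj
        ((linearYoneda R (ModuleCat.{u} R)).obj Y).rightOp i).inv.unop.hom h0
      exact (congrArg (fun t => t.unop.hom h) (P.isoLeftDerivedObj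
        ((linearYoneda R (ModuleCat.{u} R)).obj Y).rightOp i).inv_hom_id).symm.trans
          (this.trans (map_zero _))
    rwa [this] at hh
  · intro h
    exact ⟨0, h, map_zero _⟩

lemma comp_right (g : Y ⟶ Y') {φ : P.complex.X i ⟶ Y} {e} (h : ERep P i φ e) :
    ERep P i (φ ≫ g) (((Ext R (ModuleCat.{u} R) i).obj (op X)).map g e) := by
  obtain ⟨x, hx, rfl⟩ := h
  have := hx.map ((NatTrans.mapHomologicalComplex
    (NatTrans.rightOp ((linearYoneda R (ModuleCat.{u} R)).map g)) (ComplexShape.down ℕ)).app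
      P.complex)
  refine ⟨_, this, ?_⟩
  have key := P.leftDerived_app_eq (NatTrans.rightOp ((linearYoneda R (ModuleCat.{u} R)).map g)) i
  rw [← Category.assoc, Iso.eq_comp_inv] at key
  exact (congrArg (fun t => t.unop.hom x) key).symm

lemma comp_left (f : X' ⟶ X) (F : P'.complex ⟶ P.complex)
    (w : F.f 0 ≫ P.π.f 0 = P'.π.f 0 ≫ f) {φ : P.complex.X i ⟶ Y} {e} (h : ERep P i φ e) :
    ERep P' i (F.f i ≫ φ) (((Ext R (ModuleCat.{u} R) i).map f.op).app Y e) := by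
  obtain ⟨x, hx, rfl⟩ := h
  refine ⟨_, hx.map (((((linearYoneda R (ModuleCat.{u} R)).obj Y).rightOp).mapHomologicalComplex
    _).map F), ?_⟩
  have key := ProjectiveResolution.isoLeftDerivedObj_hom_naturality f P' P F w
    ((linearYoneda R (ModuleCat.{u} R)).obj Y).rightOp i
  exact (congrArg (fun t => t.unop.hom x) key).symm

lemma unique {φ : P.complex.X i ⟶ Y} {e e'} (h : ERep P i φ e) (h' : ERep P i φ e') : e = e' := by
  obtain ⟨x, hx, rfl⟩ := h
  obtain ⟨y, hy, rfl⟩ := h'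
  rw [hx.unique hy]

lemma smul_eq_zero {φ : P.complex.X i ⟶ Y} {e} (h : ERep P i φ e) {r : R}
    (hr : r • 𝟙 X = 0) : r • e = 0 := by
  have w1 (A : ModuleCat.{u} R) (π : A ⟶ X) : (r • 𝟙 A) ≫ π = π ≫ (r • 𝟙 X) := by simp
  have w2 (A : ModuleCat.{u} R) (π : A ⟶ X) : (0 : A ⟶ A) ≫ π = π ≫ (r • 𝟙 X) := by simp [hr]
  have h1 := h.comp_left (P' := P) (r • 𝟙 X) (r • 𝟙 P.complex) (w1 _ _)
  have h2 := h.comp_left (P' := P) (r • 𝟙 X) 0 (w2 _ _)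
  have h3 : ERep P i (r • φ) (r • e) := h.smul r
  have h4 : ERep P i ((0 : P.complex ⟶ P.complex).f i ≫ φ) 0 := (zero_iff _).2 ⟨0, by simp⟩
  have h5 : (r • 𝟙 P.complex : P.complex ⟶ P.complex).f i ≫ φ = r • φ := by simp
  rw [h5] at h1
  rw [h3.unique h1, h2.unique h4]

end ERep
end

section
open Limits localCohomology
variable {R : Type} [CommRing R] (a : Ideal R)

/-- The chosen projective resolution of `R ⧸ a ^ n`. -/
noncomputable abbrev powRes (n : ℕ) : ProjectiveResolution (ModuleCat.of R (R ⧸ a ^ n)) :=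
  projectiveResolution _

/-- The canonical map `R ⧸ a ^ m ⟶ R ⧸ a ^ n`. -/
def powMap {m n : ℕ} (h : n ≤ m) : ModuleCat.of R (R ⧸ a ^ m) ⟶ ModuleCat.of R (R ⧸ a ^ n) :=
  ModuleCat.ofHom (Submodule.mapQ _ _ LinearMap.id (Ideal.pow_le_pow_right h))

/-- A lift of the canonical map `R ⧸ a ^ m ⟶ R ⧸ a ^ n` to the projective resolutions. -/
noncomputable def powLift {m n : ℕ} (h : n ≤ m) : (powRes a m).complex ⟶ (powRes a n).complex :=
  ProjectiveResolution.lift (powMap a h) _ _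

lemma powLift_comm {m n : ℕ} (h : n ≤ m) :
    (powLift a h).f 0 ≫ (powRes a n).π.f 0 = (powRes a m).π.f 0 ≫ powMap a h :=
  ProjectiveResolution.lift_commutes_zero _ _ _

/-- The cocycle `φ` represents the local cohomology class `t`. -/
def LRep (i n : ℕ) {Y : ModuleCat.{0} R} (φ : (powRes a n).complex.X i ⟶ Y)
    (t : (localCohomology a i).obj Y) : Prop :=
  ∃ e, ERep (powRes a n) i φ e ∧
    ((colimit.ι (diagram (idealPowersDiagram a) i) (op (op n))).app Y).hom e = t

namespace LRep
variable {a} {i n : ℕ} {Y Y' : ModuleCat.{0} R}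

/-- Evaluation of the colimit cocone defining local cohomology is a colimit cocone. -/
noncomputable def isColimitEval (a : Ideal R) (i : ℕ) (Y : ModuleCat.{0} R) :
    IsColimit (((evaluation _ _).obj Y).mapCocone
      (colimit.cocone (diagram (idealPowersDiagram a) i))) :=
  isColimitOfPreserves _ (colimit.isColimit _)

lemma exists_map_eq_zero {J : Type} [SmallCategory J] [IsFiltered J] {G : J ⥤ ModuleCat.{0} R}
    {c : Cocone G} (hc : IsColimit c) {j : J} (x : G.obj j) (h : (c.ι.app j).hom x = 0) :
    ∃ (k : J) (f : j ⟶ k), (G.map f).hom x = 0 := by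
  obtain ⟨k, f, g, hfg⟩ := Concrete.isColimit_exists_of_rep_eq G hc x (0 : G.obj j)
    (h.trans (map_zero (c.ι.app j).hom).symm)
  exact ⟨k, f, hfg.trans (map_zero (G.map g).hom)⟩

lemma exists_rep (t : (localCohomology a i).obj Y) : ∃ n φ, LRep a i n φ t := by
  obtain ⟨⟨⟨n⟩⟩, e, he⟩ := Concrete.isColimit_exists_rep _ (isColimitEval a i Y) t
  obtain ⟨φ, hφ⟩ := ERep.exists_rep (powRes a n) e
  exact ⟨n, φ, e, hφ, he⟩

lemma add {φ ψ : (powRes a n).complex.X i ⟶ Y} {s t} (h : LRep a i n φ s) (h' : LRep a i n ψ t) :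
    LRep a i n (φ + ψ) (s + t) := by
  obtain ⟨x, hx, rfl⟩ := h
  obtain ⟨y, hy, rfl⟩ := h'
  exact ⟨x + y, hx.add hy, map_add _ _ _⟩

lemma smul {φ : (powRes a n).complex.X i ⟶ Y} {t} (r : R) (h : LRep a i n φ t) :
    LRep a i n (r • φ) (r • t) := by
  obtain ⟨x, hx, rfl⟩ := h
  exact ⟨r • x, hx.smul r, map_smul _ _ _⟩

lemma cocycle {φ : (powRes a n).complex.X i ⟶ Y} {t} (h : LRep a i n φ t) :
    (powRes a n).complex.d (i + 1) i ≫ φ = 0 := by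
  obtain ⟨x, hx, rfl⟩ := h
  exact (ERep.exists_class_iff _).1 ⟨x, hx⟩

lemma exists_class {φ : (powRes a n).complex.X i ⟶ Y}
    (h : (powRes a n).complex.d (i + 1) i ≫ φ = 0) : ∃ t, LRep a i n φ t := by
  obtain ⟨x, hx⟩ := (ERep.exists_class_iff _).2 h
  exact ⟨_, x, hx, rfl⟩

lemma unique {φ : (powRes a n).complex.X i ⟶ Y} {s t} (h : LRep a i n φ s) (h' : LRep a i n φ t) :
    s = t := by
  obtain ⟨x, hx, rfl⟩ := h
  obtain ⟨y, hy, rfl⟩ := h'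
  rw [hx.unique hy]

lemma comp_right (g : Y ⟶ Y') {φ : (powRes a n).complex.X i ⟶ Y} {t} (h : LRep a i n φ t) :
    LRep a i n (φ ≫ g) (((localCohomology a i).map g).hom t) := by
  obtain ⟨x, hx, rfl⟩ := h
  refine ⟨_, hx.comp_right g, ?_⟩
  have := (colimit.ι (diagram (idealPowersDiagram a) i) (op (op n))).naturality g
  exact congrArg (fun t => t.hom x) this

lemma transition {m : ℕ} (hm : n ≤ m) {φ : (powRes a n).complex.X i ⟶ Y} {t}
    (h : LRep a i n φ t) : LRep a i m ((powLift a hm).f i ≫ φ) t := by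
  obtain ⟨x, hx, rfl⟩ := h
  refine ⟨_, hx.comp_left (powMap a hm) (powLift a hm) (powLift_comm a hm), ?_⟩
  have := colimit.w (diagram (idealPowersDiagram a) i)
    (show (op (op n) : (ℕᵒᵖ)ᵒᵖ) ⟶ op (op m) from (homOfLE hm).op.op)
  exact congrArg (fun t => (t.app Y).hom x) this

lemma coboundary (ψ : (powRes a n).complex.X (i - 1) ⟶ Y) :
    LRep a i n ((powRes a n).complex.d i (i - 1) ≫ ψ) 0 :=
  ⟨0, (ERep.zero_iff _).2 ⟨ψ, rfl⟩, map_zero _⟩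

lemma exists_coboundary {φ : (powRes a n).complex.X i ⟶ Y} (h : LRep a i n φ 0) :
    ∃ (m : ℕ) (hm : n ≤ m), ∃ ψ, (powRes a m).complex.d i (i - 1) ≫ ψ =
      (powLift a hm).f i ≫ φ := by
  obtain ⟨x, hx, h0⟩ := h
  obtain ⟨⟨⟨m⟩⟩, f, hf⟩ := exists_map_eq_zero (isColimitEval a i Y) (j := op (op n)) x h0
  have hm : n ≤ m := f.unop.unop.down.down
  have h1 := hx.comp_left (powMap a hm) (powLift a hm) (powLift_comm a hm)
  have h2 : (((Ext R (ModuleCat.{0} R) i).map (powMap a hm).op).app Y).hom x = 0 := hf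
  exact ⟨m, hm, (ERep.zero_iff _).1 (h2 ▸ h1)⟩

lemma smul_eq_zero {φ : (powRes a n).complex.X i ⟶ Y} {t} (h : LRep a i n φ t) {r : R}
    (hr : r ∈ a ^ n) : r • t = 0 := by
  obtain ⟨x, hx, rfl⟩ := h
  refine (map_smul ((colimit.ι (diagram (idealPowersDiagram a) i) (op (op n))).app Y).hom
    r x).symm.trans ((congrArg _ (hx.smul_eq_zero ?_)).trans (map_zero _))
  ext
  exact Ideal.Quotient.eq_zero_iff_mem.2 (by simpa using hr)

end LRep
end

section
variable {R : Type} [CommRing R] {a : Ideal R} {i : ℕ}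

namespace LRep

variable {S : ShortComplex (ModuleCat.{0} R)}

lemma exact_middle (hS : S.ShortExact) (t : (localCohomology a i).obj S.X₂)
    (ht : ((localCohomology a i).map S.g).hom t = 0) :
    ∃ s, ((localCohomology a i).map S.f).hom s = t := by
  have := hS.mono_f
  have := hS.epi_g
  obtain ⟨n, φ, hφ⟩ := exists_rep t
  have h1 := hφ.comp_right S.g
  rw [ht] at h1
  obtain ⟨m, hm, ψ, hψ⟩ := exists_coboundary h1
  have h2 : ((powLift a hm).f i ≫ φ -
      (powRes a m).complex.d i (i - 1) ≫ Projective.factorThru ψ S.g) ≫ S.g = 0 := by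
    simp [hψ]
  have h3 := hS.exact.lift_f _ h2
  have h4 : (powRes a m).complex.d (i + 1) i ≫ hS.exact.lift _ h2 = 0 := by
    rw [← cancel_mono S.f, Category.assoc, h3]
    have := (hφ.transition hm).cocycle
    simp [Preadditive.comp_sub, this]
  obtain ⟨s, hs⟩ := exists_class h4
  refine ⟨s, ?_⟩
  have h5 := (hs.comp_right S.f).add (coboundary (Projective.factorThru ψ S.g))
  rw [h3, sub_add_cancel, add_zero] at h5
  exact h5.unique (hφ.transition hm)

lemma surjective_of_vanishing (hS : S.ShortExact)
    (h0 : ∀ t : (localCohomology a (i + 1)).obj S.X₁, t = 0) (t : (localCohomology a i).obj S.X₃) :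
    ∃ s, ((localCohomology a i).map S.g).hom s = t := by
  have := hS.mono_f
  have := hS.epi_g
  obtain ⟨n, χ, hχ⟩ := exists_rep t
  have hψ : Projective.factorThru χ S.g ≫ S.g = χ := Projective.factorThru_comp _ _
  set ψ := Projective.factorThru χ S.g
  have h1 : ((powRes a n).complex.d (i + 1) i ≫ ψ) ≫ S.g = 0 := by
    rw [Category.assoc, hψ, hχ.cocycle]
  have h2 := hS.exact.lift_f _ h1
  set φ := hS.exact.lift _ h1
  have h3 : (powRes a n).complex.d (i + 1 + 1) (i + 1) ≫ φ = 0 := by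
    rw [← cancel_mono S.f, Category.assoc, h2]
    simp
  obtain ⟨u, hu⟩ := exists_class h3
  rw [h0 u] at hu
  obtain ⟨m, hm, (θ : (powRes a m).complex.X i ⟶ S.X₁),
    (hθ : (powRes a m).complex.d (i + 1) i ≫ θ = _)⟩ := exists_coboundary hu
  have h4 : (powRes a m).complex.d (i + 1) i ≫ ((powLift a hm).f i ≫ ψ - θ ≫ S.f) = 0 := by
    rw [Preadditive.comp_sub, ← Category.assoc, ← Category.assoc, hθ, Category.assoc,
      Category.assoc, h2]
    simp
  obtain ⟨s, hs⟩ := exists_class h4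
  refine ⟨s, ?_⟩
  have h5 := hs.comp_right S.g
  have h6 : ((powLift a hm).f i ≫ ψ - θ ≫ S.f) ≫ S.g = (powLift a hm).f i ≫ χ := by
    simp [hψ]
  rw [h6] at h5
  exact h5.unique (hχ.transition hm)

lemma injective_of_surjective (hS : S.ShortExact)
    (h0 : ∀ t, ∃ s, ((localCohomology a i).map S.g).hom s = t)
    (t : (localCohomology a (i + 1)).obj S.X₁)
    (ht : ((localCohomology a (i + 1)).map S.f).hom t = 0) : t = 0 := by
  have := hS.mono_f
  have := hS.epi_g
  obtain ⟨n, φ, hφ⟩ := exists_rep t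
  have h1 := hφ.comp_right S.f
  rw [ht] at h1
  obtain ⟨m, hm, (ψ : (powRes a m).complex.X i ⟶ S.X₂),
    (hψ : (powRes a m).complex.d (i + 1) i ≫ ψ = _)⟩ := exists_coboundary h1
  have h2 : (powRes a m).complex.d (i + 1) i ≫ ψ ≫ S.g = 0 := by
    rw [← Category.assoc, hψ]; simp
  obtain ⟨u, hu⟩ := exists_class h2
  obtain ⟨v, rfl⟩ := h0 u
  obtain ⟨k, ω, hω⟩ := exists_rep v
  have hmp := le_max_left m k
  have hkp := le_max_right m k
  generalize max m k = p at hmp hkp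
  set ψ' := (powLift a hmp).f i ≫ ψ - (powLift a hkp).f i ≫ ω
  have hψ' : (powRes a p).complex.d (i + 1) i ≫ ψ' =
      ((powLift a hmp).f (i + 1) ≫ (powLift a hm).f (i + 1) ≫ φ) ≫ S.f := by
    have e1 := (hω.transition hkp).cocycle
    have e2 : (powRes a p).complex.d (i + 1) i ≫ (powLift a hmp).f i ≫ ψ =
        ((powLift a hmp).f (i + 1) ≫ (powLift a hm).f (i + 1) ≫ φ) ≫ S.f := by
      rw [← HomologicalComplex.Hom.comm_assoc, hψ]
      simp
    simp only [ψ', Preadditive.comp_sub, e1, e2, sub_zero]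
  have h3 : LRep a i p (ψ' ≫ S.g) 0 := by
    obtain ⟨w, hw⟩ := exists_class (i := i) (φ := ψ' ≫ S.g) (by
      rw [← Category.assoc, hψ']; simp)
    have e := hw.add ((hω.transition hkp).comp_right S.g)
    have e' : ψ' ≫ S.g + ((powLift a hkp).f i ≫ ω) ≫ S.g = (powLift a hmp).f i ≫ ψ ≫ S.g := by
      simp [ψ']
    rw [e'] at e
    have e3 := e.unique (hu.transition hmp)
    rw [add_eq_right] at e3
    rwa [e3] at hw
  obtain ⟨l, hl, χ, hχ⟩ := exists_coboundary h3
  have h4 : ((powLift a hl).f i ≫ ψ' -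
      (powRes a l).complex.d i (i - 1) ≫ Projective.factorThru χ S.g) ≫ S.g = 0 := by
    simp [hχ]
  have h5 := hS.exact.lift_f _ h4
  set θ := hS.exact.lift _ h4
  have h6 : (powRes a l).complex.d (i + 1) i ≫ θ =
      (powLift a hl).f (i + 1) ≫ (powLift a hmp).f (i + 1) ≫ (powLift a hm).f (i + 1) ≫ φ := by
    rw [← cancel_mono S.f, Category.assoc, h5, Preadditive.comp_sub,
      ← HomologicalComplex.Hom.comm_assoc, hψ']
    simp
  exact (((hφ.transition hm).transition hmp).transition hl).unique
    (h6 ▸ coboundary (i := i + 1) θ)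

lemma eq_zero_of_injective (Y : ModuleCat.{0} R) [Injective Y]
    (t : (localCohomology a (i + 1)).obj Y) : t = 0 := by
  obtain ⟨n, φ, hφ⟩ := exists_rep t
  have h1 := (powRes a n).exact_succ i
  have h2 := h1.comp_descToInjective φ hφ.cocycle
  have h3 := coboundary (i := i + 1) (h1.descToInjective φ hφ.cocycle)
  exact hφ.unique (h2 ▸ h3)

/-- The augmentation of the chosen resolution of `R ⧸ a ^ n`. -/
noncomputable def aug (a : Ideal R) (n : ℕ) :
    (powRes a n).complex.X 0 ⟶ ModuleCat.of R (R ⧸ a ^ n) :=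
  (powRes a n).π.f 0

lemma d_comp_aug (n : ℕ) : (powRes a n).complex.d 1 0 ≫ aug a n = 0 :=
  (powRes a n).complex_d_comp_π_f_zero

lemma powLift_comp_aug {m n : ℕ} (h : n ≤ m) :
    (powLift a h).f 0 ≫ aug a n = aug a m ≫ powMap a h :=
  powLift_comm a h

lemma exists_desc {Y : ModuleCat.{0} R} (t : (localCohomology a 0).obj Y) :
    ∃ (n : ℕ) (f : ModuleCat.of R (R ⧸ a ^ n) ⟶ Y), LRep a 0 n (aug a n ≫ f) t := by
  obtain ⟨n, φ, hφ⟩ := exists_rep t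
  have h : (ShortComplex.mk _ _ (d_comp_aug (a := a) n)).Exact := (powRes a n).exact₀
  have : Epi (ShortComplex.mk _ _ (d_comp_aug (a := a) n)).g :=
    (inferInstance : Epi ((powRes a n).π.f 0))
  exact ⟨n, h.desc φ hφ.cocycle, (h.g_desc φ hφ.cocycle).symm ▸ hφ⟩

lemma surjective_zero {Y Z : ModuleCat.{0} R} (g : Y ⟶ Z) (hg : Function.Surjective g.hom)
    (hY : ∀ y : Y, ∃ n : ℕ, ∀ r ∈ a ^ n, r • y = 0) (t : (localCohomology a 0).obj Z) :
    ∃ s, ((localCohomology a 0).map g).hom s = t := by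
  obtain ⟨n, f, hf⟩ := exists_desc t
  obtain ⟨y, hy⟩ := hg (f.hom (Ideal.Quotient.mk _ 1))
  obtain ⟨k, hk⟩ := hY y
  have hnm := le_max_left n k
  have hkm := le_max_right n k
  generalize max n k = m at hnm hkm
  let f' : ModuleCat.of R (R ⧸ a ^ m) ⟶ Y := ModuleCat.ofHom
    (Submodule.liftQ _ (LinearMap.toSpanSingleton R Y y)
      fun r hr => hk r (Ideal.pow_le_pow_right hkm hr))
  have h1 : f' ≫ g = powMap a hnm ≫ f := by
    refine ModuleCat.hom_ext (Submodule.linearMap_qext _ (LinearMap.ext_ring ?_))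
    have : f'.hom (Submodule.Quotient.mk 1) = y := one_smul R y
    exact (congrArg g.hom this).trans hy
  obtain ⟨s, hs⟩ := exists_class (a := a) (i := 0) (n := m) (φ := aug a m ≫ f') (by
    rw [← Category.assoc, d_comp_aug, Limits.zero_comp])
  refine ⟨s, (hs.comp_right g).unique ?_⟩
  rw [Category.assoc, h1, ← Category.assoc, ← powLift_comp_aug, Category.assoc]
  exact hf.transition hnm

end LRep
end

namespace TopLC
variable {R : Type} [CommRing R] {a : Ideal R} {i : ℕ}
  {L M N : Type} [AddCommGroup L] [Module R L] [AddCommGroup M] [Module R M]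
  [AddCommGroup N] [Module R N]

variable (a i) in
/-- Functoriality of local cohomology. -/
noncomputable def map (f : M →ₗ[R] N) : TopLC R a i M →ₗ[R] TopLC R a i N :=
  ((localCohomology a i).map (ModuleCat.ofHom f)).hom

lemma map_id (t : TopLC R a i M) : map a i LinearMap.id t = t :=
  congrArg (fun f => f.hom t) ((localCohomology a i).map_id (ModuleCat.of R M))

lemma map_comp (g : M →ₗ[R] N) (f : L →ₗ[R] M) (t : TopLC R a i L) :
    map a i (g ∘ₗ f) t = map a i g (map a i f t) :=
  congrArg (fun f => f.hom t)
    ((localCohomology a i).map_comp (ModuleCat.ofHom f) (ModuleCat.ofHom g))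

lemma map_hom_add (f g : M →ₗ[R] N) (t : TopLC R a i M) :
    map a i (f + g) t = map a i f t + map a i g t := by
  obtain ⟨n, φ, hφ⟩ := LRep.exists_rep (Y := ModuleCat.of R M) t
  refine (hφ.comp_right (ModuleCat.ofHom (f + g))).unique ?_
  rw [ModuleCat.ofHom_add, Preadditive.comp_add]
  exact (hφ.comp_right (ModuleCat.ofHom f)).add (hφ.comp_right (ModuleCat.ofHom g))

lemma map_hom_smul (r : R) (f : M →ₗ[R] N) (t : TopLC R a i M) :
    map a i (r • f) t = r • map a i f t := by
  obtain ⟨n, φ, hφ⟩ := LRep.exists_rep (Y := ModuleCat.of R M) t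
  refine (hφ.comp_right (ModuleCat.ofHom (r • f))).unique ?_
  have : ModuleCat.ofHom (r • f) = r • ModuleCat.ofHom f := rfl
  rw [this, Linear.comp_smul]
  exact (hφ.comp_right (ModuleCat.ofHom f)).smul r

lemma map_smul_id (r : R) (t : TopLC R a i M) :
    map a i (r • LinearMap.id : M →ₗ[R] M) t = r • t := by
  rw [map_hom_smul, map_id]

lemma map_hom_zero (t : TopLC R a i M) : map a i (0 : M →ₗ[R] N) t = 0 := by
  simpa using map_hom_smul (0 : R) (0 : M →ₗ[R] N) t

lemma smul_eq_zero_of_forall {r : R} (h : ∀ m : M, r • m = 0) (t : TopLC R a i M) :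
    r • t = 0 := by
  rw [← map_smul_id, show (r • LinearMap.id : M →ₗ[R] M) = 0 from LinearMap.ext h, map_hom_zero]

lemma exists_pow_smul_eq_zero (t : TopLC R a i M) : ∃ n, ∀ r ∈ a ^ n, r • t = 0 := by
  obtain ⟨n, φ, hφ⟩ := LRep.exists_rep (Y := ModuleCat.of R M) t
  exact ⟨n, fun r hr => hφ.smul_eq_zero hr⟩

lemma subsingleton_of_subsingleton [Subsingleton M] : Subsingleton (TopLC R a i M) :=
  subsingleton_of_forall_eq 0 fun t => by
    rw [← map_id t, show (LinearMap.id : M →ₗ[R] M) = 0 from Subsingleton.elim _ _, map_hom_zero]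

lemma subsingleton_of_equiv (e : M ≃ₗ[R] N) [Subsingleton (TopLC R a i N)] :
    Subsingleton (TopLC R a i M) :=
  subsingleton_of_forall_eq 0 fun t => by
    have h : map a i (e.symm.toLinearMap ∘ₗ e.toLinearMap) t = t := by
      rw [show e.symm.toLinearMap ∘ₗ e.toLinearMap = LinearMap.id from LinearMap.ext (by simp),
        map_id]
    rw [← h, map_comp, Subsingleton.elim (map a i e.toLinearMap t) 0, map_zero]

variable {f : L →ₗ[R] M} {g : M →ₗ[R] N}

/-- The short exact sequence of modules attached to an exact pair of linear maps. -/
lemma exists_shortExact (hf : Function.Injective f) (hfg : Function.Exact f g)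
    (hg : Function.Surjective g) : ∃ h : ModuleCat.ofHom f ≫ ModuleCat.ofHom g = 0,
    (ShortComplex.mk (ModuleCat.ofHom f) (ModuleCat.ofHom g) h).ShortExact := by
  refine ⟨ModuleCat.hom_ext hfg.linearMap_comp_eq_zero, ?_⟩
  have : Mono (ModuleCat.ofHom f) := (ModuleCat.mono_iff_injective _).2 hf
  have : Epi (ModuleCat.ofHom g) := (ModuleCat.epi_iff_surjective _).2 hg
  exact
    { exact := (ShortComplex.ShortExact.moduleCat_exact_iff_function_exact _).2 hfg
      mono_f := ‹_›
      epi_g := ‹_› }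

lemma exact_middle (hf : Function.Injective f) (hfg : Function.Exact f g)
    (hg : Function.Surjective g) : Function.Exact (map a i f) (map a i g) := by
  obtain ⟨h, hS⟩ := exists_shortExact hf hfg hg
  refine fun t => ⟨LRep.exact_middle hS t, ?_⟩
  rintro ⟨s, rfl⟩
  rw [← map_comp, hfg.linearMap_comp_eq_zero, map_hom_zero]

lemma surjective_of_vanishing (hf : Function.Injective f) (hfg : Function.Exact f g)
    (hg : Function.Surjective g) [Subsingleton (TopLC R a (i + 1) L)] :
    Function.Surjective (map a i g) := by
  obtain ⟨h, hS⟩ := exists_shortExact hf hfg hg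
  exact LRep.surjective_of_vanishing (a := a) hS
    fun t => Subsingleton.elim (α := TopLC R a (i + 1) L) t 0

lemma injective_of_surjective (hf : Function.Injective f) (hfg : Function.Exact f g)
    (hg : Function.Surjective g) (h' : Function.Surjective (map a i g)) :
    Function.Injective (map a (i + 1) f) := by
  obtain ⟨h, hS⟩ := exists_shortExact hf hfg hg
  exact (injective_iff_map_eq_zero _).2 (LRep.injective_of_surjective (a := a) hS h')

lemma surjective_zero (hg : Function.Surjective g) (hM : ∀ y : M, ∃ n : ℕ, ∀ r ∈ a ^ n, r • y = 0) :
    Function.Surjective (map a 0 g) :=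
  LRep.surjective_zero (ModuleCat.ofHom g) hg hM

lemma subsingleton_of_injective (h : Module.Baer R M) : Subsingleton (TopLC R a (i + 1) M) := by
  have := h.injective
  have : Injective (ModuleCat.of R M) := Module.injective_object_of_injective_module R M
  exact subsingleton_of_forall_eq (α := TopLC R a (i + 1) M) 0
    (LRep.eq_zero_of_injective (a := a) (i := i) (ModuleCat.of R M))

end TopLC

section
variable {R : Type} [CommRing R] (a : Ideal R) (M : Type) [AddCommGroup M] [Module R M]

/-- The submodule of elements killed by some power of the ideal `a`. -/
def powTorsion : Submodule R M where
  carrier := {m | ∃ n : ℕ, ∀ r ∈ a ^ n, r • m = 0}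
  zero_mem' := ⟨0, fun _ _ => smul_zero _⟩
  add_mem' := by
    rintro x y ⟨n, hx⟩ ⟨m, hy⟩
    refine ⟨max n m, fun r hr => ?_⟩
    rw [smul_add, hx r (Ideal.pow_le_pow_right (le_max_left n m) hr),
      hy r (Ideal.pow_le_pow_right (le_max_right n m) hr), add_zero]
  smul_mem' := by
    rintro c x ⟨n, hx⟩
    exact ⟨n, fun r hr => by rw [smul_comm, hx r hr, smul_zero]⟩

variable {a M}

lemma mem_powTorsion {m : M} : m ∈ powTorsion a M ↔ ∃ n : ℕ, ∀ r ∈ a ^ n, r • m = 0 := Iff.rfl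

/-- A finitely generated module which is `a`-power torsion is killed by a power of `a`. -/
lemma exists_pow_le_annihilator [Module.Finite R M] (h : powTorsion a M = ⊤) :
    ∃ n : ℕ, ∀ r ∈ a ^ n, ∀ m : M, r • m = 0 := by
  obtain ⟨s, hs⟩ := Module.Finite.fg_top (R := R) (M := M)
  have h1 : ∀ m : M, ∃ n : ℕ, ∀ r ∈ a ^ n, r • m = 0 := fun m =>
    mem_powTorsion.1 (h ▸ Submodule.mem_top)
  choose k hk using h1
  refine ⟨s.sup k, fun r hr m => ?_⟩
  have : Submodule.span R (s : Set M) ≤ (LinearMap.lsmul R M r).ker :=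
    Submodule.span_le.2 fun x hx =>
      hk x r (Ideal.pow_le_pow_right (Finset.le_sup (f := k) hx) hr)
  exact this (hs ▸ Submodule.mem_top)

lemma baer_powTorsion [IsNoetherianRing R] (h : Module.Baer R M) :
    Module.Baer R (powTorsion a M) := by
  intro I g
  obtain ⟨n, hn⟩ : ∃ n : ℕ, ∀ r ∈ a ^ n, ∀ x : g.range, r • x = 0 := by
    have : Module.Finite R g.range := Module.Finite.range g
    refine exists_pow_le_annihilator (M := g.range) (eq_top_iff.2 ?_)
    rintro ⟨⟨_, n, hn⟩, hx⟩ -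
    exact ⟨n, fun r hr => Subtype.ext (Subtype.ext (hn r hr))⟩
  obtain ⟨k, hk⟩ := Ideal.exists_pow_inf_eq_pow_smul a I
  have h1 : ∀ x : I, (x : R) ∈ a ^ (n + k) → g x = 0 := by
    have h2 : a ^ (n + k) ⊓ I ≤ a ^ n • I := by
      have := hk (n + k) (Nat.le_add_left k n)
      rw [smul_eq_mul, Ideal.mul_top] at this
      rw [this, Nat.add_sub_cancel]
      exact Submodule.smul_mono le_rfl inf_le_right
    have h3 : a ^ n • I ≤ Submodule.map I.subtype g.ker := by
      refine Submodule.smul_le.2 fun r hr x hx => ⟨r • ⟨x, hx⟩, ?_, rfl⟩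
      have := hn r hr ⟨g ⟨x, hx⟩, LinearMap.mem_range_self _ _⟩
      exact (map_smul g r _).trans (congrArg Subtype.val this)
    intro x hx
    obtain ⟨y, hy, hxy⟩ := h3 (h2 ⟨hx, x.2⟩)
    rwa [← Subtype.ext hxy]
  let f₁ : R →ₗ.[R] M := ⟨I, (powTorsion a M).subtype ∘ₗ g⟩
  let f₂ : R →ₗ.[R] M := ⟨a ^ (n + k), 0⟩
  have h4 : ∀ (x : f₁.domain) (y : f₂.domain), (x : R) = y → f₁ x = f₂ y := fun x y hxy =>
    congrArg Subtype.val (h1 x (hxy ▸ y.2))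
  obtain ⟨g', hg'⟩ := h (f₁.sup f₂ h4).domain (f₁.sup f₂ h4).toFun
  have h5 : ∀ r ∈ a ^ (n + k), r • g' 1 = 0 := fun r hr => by
    rw [← map_smul, smul_eq_mul, mul_one, hg' r (Submodule.mem_sup_right hr)]
    exact ((LinearPMap.right_le_sup f₁ f₂ h4).2 (x := ⟨r, hr⟩) rfl).symm
  refine ⟨LinearMap.toSpanSingleton R _ ⟨g' 1, n + k, h5⟩, fun x hx => Subtype.ext ?_⟩
  have h6 : x • g' 1 = g' x := by rw [← map_smul, smul_eq_mul, mul_one]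
  refine h6.trans ((hg' x (Submodule.mem_sup_left hx)).trans ?_)
  exact ((LinearPMap.left_le_sup f₁ f₂ h4).2 (x := ⟨x, hx⟩) rfl).symm

end

namespace TopLC
variable {R : Type} [CommRing R] [IsNoetherianRing R] {a : Ideal R}

lemma exists_injective_powTorsion {N : Type} [AddCommGroup N] [Module R N]
    (hN : powTorsion a N = ⊤) :
    ∃ (G : Type) (_ : AddCommGroup G) (_ : Module R G) (f : N →ₗ[R] G),
      Function.Injective f ∧ Module.Baer R G ∧ powTorsion a G = ⊤ := by
  let E := Injective.under (ModuleCat.of R N)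
  have hE : Module.Injective R E :=
    have : Injective (ModuleCat.of R E) := inferInstanceAs (Injective (Injective.under _))
    Module.injective_module_of_injective_object R E
  let ι : N →ₗ[R] E := (Injective.ι (ModuleCat.of R N)).hom
  have hι : Function.Injective ι := (ModuleCat.mono_iff_injective _).1 inferInstance
  have h : ∀ x, ι x ∈ powTorsion a E := fun x => by
    obtain ⟨n, hn⟩ := mem_powTorsion.1 (hN ▸ Submodule.mem_top : x ∈ powTorsion a N)
    exact ⟨n, fun r hr => by rw [← map_smul, hn r hr, map_zero]⟩
  refine ⟨powTorsion a E, inferInstance, inferInstance, ι.codRestrict _ h,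
    fun x y hxy => hι (congrArg Subtype.val hxy), baer_powTorsion (Module.Baer.of_injective hE),
    eq_top_iff.2 ?_⟩
  rintro ⟨_, n, hn⟩ -
  exact ⟨n, fun r hr => Subtype.ext (hn r hr)⟩

/-- Local cohomology of an `a`-power torsion module vanishes in positive degrees. -/
lemma subsingleton_of_powTorsion (i : ℕ) {N : Type} [AddCommGroup N] [Module R N]
    (hN : powTorsion a N = ⊤) : Subsingleton (TopLC R a (i + 1) N) := by
  induction i generalizing N with
  | zero =>
    obtain ⟨G, _, _, f, hf, hG, hG'⟩ := exists_injective_powTorsion hN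
    have := subsingleton_of_injective (a := a) (i := 0) hG
    exact (injective_of_surjective hf (LinearMap.exact_map_mkQ_range f) (Submodule.mkQ_surjective _)
      (surjective_zero (Submodule.mkQ_surjective _)
        fun y => mem_powTorsion.1 (hG' ▸ Submodule.mem_top))).subsingleton
  | succ i ih =>
    obtain ⟨G, _, _, f, hf, hG, hG'⟩ := exists_injective_powTorsion hN
    have := subsingleton_of_injective (a := a) (i := i + 1) hG
    have : Subsingleton (TopLC R a (i + 1) (G ⧸ f.range)) := by
      refine ih (eq_top_iff.2 fun y _ => ?_)
      obtain ⟨x, rfl⟩ := Submodule.mkQ_surjective _ y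
      obtain ⟨n, hn⟩ := mem_powTorsion.1 (hG' ▸ Submodule.mem_top : x ∈ powTorsion a G)
      exact ⟨n, fun r hr => by rw [← map_smul, hn r hr, map_zero]⟩
    exact (injective_of_surjective hf (LinearMap.exact_map_mkQ_range f) (Submodule.mkQ_surjective _)
      (Function.surjective_to_subsingleton _)).subsingleton

end TopLC

section
variable {R : Type} [CommRing R]

variable (R) in
/-- The support of `N` has dimension less than `n`. -/
def DimLT (n : ℕ) (N : Type) [AddCommGroup N] [Module R N] : Prop :=
  ∀ p ∈ Module.support R N, ringKrullDim (R ⧸ p.asIdeal) < n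

variable {n : ℕ} {L M N : Type} [AddCommGroup L] [Module R L] [AddCommGroup M] [Module R M]
  [AddCommGroup N] [Module R N]

lemma DimLT.of_injective (h : DimLT R n M) (f : L →ₗ[R] M) (hf : Function.Injective f) :
    DimLT R n L :=
  fun p hp => h p (Module.support_subset_of_injective f hf hp)

lemma DimLT.of_surjective (h : DimLT R n M) (f : M →ₗ[R] N) (hf : Function.Surjective f) :
    DimLT R n N :=
  fun p hp => h p (Module.support_subset_of_surjective f hf hp)

lemma DimLT.mono (h : DimLT R n M) {m : ℕ} (hnm : n ≤ m) : DimLT R m M :=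
  fun p hp => (h p hp).trans_le (by exact_mod_cast hnm)

lemma ringKrullDim_quotient_le_of_le {I J : Ideal R} (h : I ≤ J) :
    ringKrullDim (R ⧸ J) ≤ ringKrullDim (R ⧸ I) :=
  ringKrullDim_le_of_surjective (Ideal.Quotient.factor h) (Ideal.Quotient.factor_surjective h)

lemma ringKrullDim_quotient_succ_le_of_lt {I J : Ideal R} [I.IsPrime] (h : I < J) :
    ringKrullDim (R ⧸ J) + 1 ≤ ringKrullDim (R ⧸ I) := by
  obtain ⟨x, hx, hx'⟩ := SetLike.exists_of_lt h
  refine ringKrullDim_succ_le_of_surjective (Ideal.Quotient.factor h.le)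
    (Ideal.Quotient.factor_surjective h.le) (r := Ideal.Quotient.mk I x)
    (mem_nonZeroDivisors_of_ne_zero (mt Ideal.Quotient.eq_zero_iff_mem.1 hx')) ?_
  simpa [Ideal.Quotient.eq_zero_iff_mem] using hx

lemma ringKrullDim_quotient_lt_of_lt {I J : Ideal R} [I.IsPrime] (h : I < J)
    (hI : ringKrullDim (R ⧸ I) < (n + 1 : ℕ)) : ringKrullDim (R ⧸ J) < n := by
  have := (ringKrullDim_quotient_succ_le_of_lt h).trans_lt hI
  rw [Nat.cast_add, Nat.cast_one] at this
  exact lt_of_add_lt_add_right this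

lemma mem_support_quotient_iff {I : Ideal R} {p : PrimeSpectrum R} :
    p ∈ Module.support R (R ⧸ I) ↔ I ≤ p.asIdeal := by
  rw [Module.mem_support_iff_of_finite, Ideal.annihilator_quotient]

lemma dimLT_quotient_iff {p : Ideal R} [hp : p.IsPrime] :
    DimLT R n (R ⧸ p) ↔ ringKrullDim (R ⧸ p) < n :=
  ⟨fun h => h ⟨p, hp⟩ (mem_support_quotient_iff.2 le_rfl), fun h _ hq =>
    (ringKrullDim_quotient_le_of_le (mem_support_quotient_iff.1 hq)).trans_lt h⟩

lemma DimLT.subsingleton (h : DimLT R 0 N) : Subsingleton N := by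
  by_contra hN
  rw [not_subsingleton_iff_nontrivial] at hN
  obtain ⟨p, hp⟩ := Module.nonempty_support_of_nontrivial (R := R) (M := N)
  exact (h p hp).not_ge (by exact_mod_cast ringKrullDim_nonneg_of_nontrivial)

lemma mem_support_smul_coker {x : R} {p : PrimeSpectrum R}
    (hp : p ∈ Module.support R (N ⧸ (x • LinearMap.id : N →ₗ[R] N).range)) :
    p ∈ Module.support R N ∧ x ∈ p.asIdeal := by
  refine ⟨Module.support_subset_of_surjective _ (Submodule.mkQ_surjective _) hp,
    Module.annihilator_le_of_mem_support hp (Module.mem_annihilator.2 fun y => ?_)⟩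
  obtain ⟨y, rfl⟩ := Submodule.mkQ_surjective _ y
  rw [← map_smul]
  exact (Submodule.Quotient.mk_eq_zero _).2 ⟨y, rfl⟩

/-- Grothendieck's vanishing theorem. -/
theorem DimLT.subsingleton_topLC [IsNoetherianRing R] (a : Ideal R) [Module.Finite R N]
    (hN : DimLT R n N) : Subsingleton (TopLC R a n N) := by
  induction n generalizing N with
  | zero =>
    have := hN.subsingleton
    exact TopLC.subsingleton_of_subsingleton
  | succ n ih =>
    revert hN
    refine IsNoetherianRing.induction_on_isQuotientEquivQuotientPrime R (M := N) inferInstance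
      (motive := fun N _ _ _ => DimLT R (n + 1) N → Subsingleton (TopLC R a (n + 1) N)) ?_ ?_ ?_
    · intro N _ _ _ _ _
      exact TopLC.subsingleton_of_subsingleton
    · intro N _ _ _ q e h
      replace h := dimLT_quotient_iff.1 (h.of_surjective e.toLinearMap e.surjective)
      suffices Subsingleton (TopLC R a (n + 1) (R ⧸ q.asIdeal)) from TopLC.subsingleton_of_equiv e
      by_cases haq : a ≤ q.asIdeal
      · refine TopLC.subsingleton_of_powTorsion n (eq_top_iff.2 fun y _ => ⟨1, fun r hr => ?_⟩)
        obtain ⟨y, rfl⟩ := Ideal.Quotient.mk_surjective y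
        rw [pow_one] at hr
        exact Ideal.Quotient.eq_zero_iff_mem.2 (q.asIdeal.mul_mem_right y (haq hr))
      · obtain ⟨x, hxa, hxq⟩ := SetLike.not_le_iff_exists.1 haq
        have hinj : Function.Injective (x • LinearMap.id : (R ⧸ q.asIdeal) →ₗ[R] R ⧸ q.asIdeal) := by
          refine (injective_iff_map_eq_zero _).2 fun y hy => ?_
          obtain ⟨y, rfl⟩ := Ideal.Quotient.mk_surjective y
          have : x * y ∈ q.asIdeal := Ideal.Quotient.eq_zero_iff_mem.1 hy
          exact Ideal.Quotient.eq_zero_iff_mem.2 ((q.2.mem_or_mem this).resolve_left hxq)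
        have := ih (N := (R ⧸ q.asIdeal) ⧸
            (x • LinearMap.id : (R ⧸ q.asIdeal) →ₗ[R] R ⧸ q.asIdeal).range)
          fun p hp => ringKrullDim_quotient_lt_of_lt (lt_of_le_of_ne
            (mem_support_quotient_iff.1 (mem_support_smul_coker hp).1)
            fun h => hxq (h ▸ (mem_support_smul_coker hp).2)) h
        have hx := TopLC.injective_of_surjective (a := a) (i := n) hinj
          (LinearMap.exact_map_mkQ_range _) (Submodule.mkQ_surjective _)
          (Function.surjective_to_subsingleton _)
        have hx' : ∀ (k : ℕ) (t : TopLC R a (n + 1) (R ⧸ q.asIdeal)), x ^ k • t = 0 → t = 0 := by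
          intro k
          induction k with
          | zero => simp
          | succ k ihk =>
            refine fun t ht => (injective_iff_map_eq_zero _).1 hx t ?_
            rw [TopLC.map_smul_id]
            exact ihk _ (by rwa [smul_smul, ← pow_succ])
        refine subsingleton_of_forall_eq 0 fun t => ?_
        obtain ⟨k, hk⟩ := TopLC.exists_pow_smul_eq_zero t
        exact hx' k t (hk _ (Ideal.pow_mem_pow hxa k))
    · intro N₁ _ _ _ N₂ _ _ _ N₃ _ _ _ f g hf hg hfg h₁ h₃ h
      have := h₁ (h.of_injective f hf)
      have := h₃ (h.of_surjective g hg)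
      have h' := TopLC.exact_middle (a := a) (i := n + 1) hf hfg hg
      refine subsingleton_of_forall_eq 0 fun t => ?_
      obtain ⟨s, rfl⟩ := (h' t).1 (Subsingleton.elim _ _)
      rw [Subsingleton.elim s 0, map_zero]
end

section
variable {R : Type} [CommRing R] {M : Type} [AddCommGroup M] [Module R M]

/-- A submodule which is zero or `p`-secondary. -/
def IsSecOrBot (p : Ideal R) (S : Submodule R M) : Prop :=
  (∀ x ∉ p, ∀ m ∈ S, ∃ s ∈ S, x • s = m) ∧ ∀ x ∈ p, ∃ n : ℕ, ∀ m ∈ S, x ^ n • m = 0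

lemma exists_pow_smul_eq {S : Submodule R M} {x : R} (h : ∀ m ∈ S, ∃ s ∈ S, x • s = m) (n : ℕ) :
    ∀ m ∈ S, ∃ s ∈ S, x ^ n • s = m := by
  induction n with
  | zero => exact fun m hm => ⟨m, hm, by simp⟩
  | succ n ih =>
    intro m hm
    obtain ⟨s, hs, rfl⟩ := ih m hm
    obtain ⟨u, hu, rfl⟩ := h s hs
    exact ⟨u, hu, by rw [pow_succ, mul_smul]⟩

lemma mem_radical_annihilator {S : Submodule R M} {x : R} :
    x ∈ S.annihilator.radical ↔ ∃ n : ℕ, ∀ m ∈ S, x ^ n • m = 0 := by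
  simp only [Ideal.mem_radical_iff, Submodule.mem_annihilator]

lemma eq_bot_of_surjective_of_nilpotent {S : Submodule R M} {x : R}
    (h : ∀ m ∈ S, ∃ s ∈ S, x • s = m) (h' : ∃ n : ℕ, ∀ m ∈ S, x ^ n • m = 0) : S = ⊥ := by
  obtain ⟨n, hn⟩ := h'
  refine (Submodule.eq_bot_iff _).2 fun m hm => ?_
  obtain ⟨s, hs, rfl⟩ := exists_pow_smul_eq h n m hm
  exact hn s hs

namespace IsSecOrBot
variable {p : Ideal R} {S : Submodule R M}

lemma map (h : IsSecOrBot p S) {N : Type} [AddCommGroup N] [Module R N] (f : M →ₗ[R] N) :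
    IsSecOrBot p (S.map f) := by
  constructor
  · rintro x hx _ ⟨m, hm, rfl⟩
    obtain ⟨s, hs, rfl⟩ := h.1 x hx m hm
    exact ⟨f s, ⟨s, hs, rfl⟩, (map_smul f x s).symm⟩
  · intro x hx
    obtain ⟨n, hn⟩ := h.2 x hx
    refine ⟨n, ?_⟩
    rintro _ ⟨m, hm, rfl⟩
    rw [← map_smul, hn m hm, map_zero]

lemma radical_annihilator_eq (h : IsSecOrBot p S) (hS : S ≠ ⊥) : S.annihilator.radical = p := by
  ext x
  rw [mem_radical_annihilator]
  exact ⟨fun hx => by_contra fun hxp => hS (eq_bot_of_surjective_of_nilpotent (h.1 x hxp) hx),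
    h.2 x⟩

lemma isSecondarySub (h : IsSecOrBot p S) (hS : S ≠ ⊥) : IsSecondarySub R S :=
  ⟨hS, fun x => (em (x ∈ p)).symm.imp (h.1 x) (h.2 x)⟩

end IsSecOrBot

lemma IsSecondarySub.isSecOrBot {S : Submodule R M} (h : IsSecondarySub R S) :
    IsSecOrBot S.annihilator.radical S :=
  ⟨fun x hx => (h.2 x).resolve_right (mt mem_radical_annihilator.2 hx),
    fun _ => mem_radical_annihilator.1⟩

lemma IsSecondarySub.isPrime {S : Submodule R M} (h : IsSecondarySub R S) :
    S.annihilator.radical.IsPrime := by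
  refine ⟨fun h1 => h.1 ?_, fun {x y} hxy => or_iff_not_imp_left.2 fun hx => ?_⟩
  · rw [Ideal.radical_eq_top, Submodule.annihilator_eq_top_iff] at h1
    exact h1
  · obtain ⟨n, hn⟩ := mem_radical_annihilator.1 hxy
    refine mem_radical_annihilator.2 ⟨n, fun m hm => ?_⟩
    obtain ⟨s, hs, rfl⟩ := exists_pow_smul_eq (h.isSecOrBot.1 x hx) n m hm
    rw [smul_smul, ← mul_pow, mul_comm, hn s hs]

lemma exists_pow_smul_iSup_eq_zero {ι : Type} [Finite ι] {S : ι → Submodule R M} {x : R}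
    (h : ∀ i, ∃ n : ℕ, ∀ m ∈ S i, x ^ n • m = 0) : ∃ n : ℕ, ∀ m ∈ ⨆ i, S i, x ^ n • m = 0 := by
  cases nonempty_fintype ι
  choose k hk using h
  refine ⟨Finset.univ.sup k, fun m hm => ?_⟩
  have : ⨆ i, S i ≤ (LinearMap.lsmul R M (x ^ Finset.univ.sup k)).ker := iSup_le fun i m hm => by
    rw [LinearMap.mem_ker, LinearMap.lsmul_apply, ← Nat.sub_add_cancel
      (Finset.le_sup (f := k) (Finset.mem_univ i)), pow_add, mul_smul, hk i m hm, smul_zero]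
  exact this hm

lemma exists_mem_and_notMem {ι : Type} [Finite ι] {P : ι → Ideal R} {p : Ideal R} [hp : p.IsPrime]
    (h : ∀ i, ¬ P i ≤ p) : ∃ x, (∀ i, x ∈ P i) ∧ x ∉ p := by
  cases nonempty_fintype ι
  have h1 : ¬ Finset.univ.inf P ≤ p := by
    rw [hp.inf_le']
    rintro ⟨i, -, hi⟩
    exact h i hi
  obtain ⟨x, hx, hxp⟩ := SetLike.not_le_iff_exists.1 h1
  exact ⟨x, fun i => (Finset.inf_le (Finset.mem_univ i) : _ ≤ P i) hx, hxp⟩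

/-- The attached primes can be read off from any secondary representation with incomparable
primes. -/
theorem attachedPrimes_eq {ι : Type} [Finite ι] {P : ι → Ideal R} (hP : ∀ i, (P i).IsPrime)
    (hP' : ∀ i j, P i ≤ P j → i = j) {S : ι → Submodule R M} (hS : ∀ i, IsSecOrBot (P i) (S i))
    (htop : ⨆ i, S i = ⊤) : AttachedPrimes R M = {p | ∃ i, S i ≠ ⊥ ∧ p = P i} := by
  ext p
  constructor
  · rintro ⟨n, S', ⟨h1, h2, -, h4⟩, j, rfl⟩
    set p := (S' j).annihilator.radical
    have hp : p.IsPrime := (h1 j).isPrime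
    set W : Submodule R M := ⨆ i ∈ ({j}ᶜ : Set (Fin n)), S' i
    have hW : (S' j).map W.mkQ = ⊤ := by
      rw [Submodule.map_mkQ_eq_top, eq_top_iff, ← h2]
      refine iSup_le fun i => ?_
      by_cases hi : i = j
      · exact hi ▸ le_sup_right
      · exact le_sup_of_le_left (le_iSup₂ (f := fun i (_ : i ∈ ({j}ᶜ : Set (Fin n))) => S' i) i hi)
    have hQ : (S' j).map W.mkQ ≠ ⊥ := fun h => h4 j (by
      have h' := LinearMap.le_ker_iff_map.2 h
      rwa [Submodule.ker_mkQ] at h')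
    have hQp := (h1 j).isSecOrBot.map W.mkQ
    rw [hW] at hQ hQp
    have htop' : ⨆ i, (S i).map W.mkQ = ⊤ := by
      rw [← Submodule.map_iSup, htop, Submodule.map_top, Submodule.range_mkQ]
    have hle : ∀ i, (S i).map W.mkQ ≠ ⊥ → p ≤ P i := fun i hi x hx => by_contra fun hxi =>
      hi (eq_bot_of_surjective_of_nilpotent (((hS i).map W.mkQ).1 x hxi)
        ((hQp.2 x hx).imp fun n hn m _ => hn m Submodule.mem_top))
    obtain ⟨i, hi, hip⟩ : ∃ i, (S i).map W.mkQ ≠ ⊥ ∧ P i ≤ p := by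
      by_contra! hcon
      obtain ⟨x, hx, hxp⟩ := exists_mem_and_notMem
        (P := fun i : {i // (S i).map W.mkQ ≠ ⊥} => P i) fun i => hcon i.1 i.2
      refine hQ (eq_bot_of_surjective_of_nilpotent (hQp.1 x hxp) ?_)
      rw [← htop']
      refine exists_pow_smul_iSup_eq_zero fun i => ?_
      by_cases hi : (S i).map W.mkQ = ⊥
      · exact ⟨0, fun m hm => by rw [(Submodule.eq_bot_iff _).1 hi m hm, smul_zero]⟩
      · exact ((hS i).map W.mkQ).2 x (hx ⟨i, hi⟩)
    exact ⟨i, fun h => hi (by rw [h, Submodule.map_bot]), (hle i hi).antisymm hip⟩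
  · rintro ⟨i, hi, rfl⟩
    obtain ⟨n, ⟨e⟩⟩ := Finite.exists_equiv_fin {i // S i ≠ ⊥}
    refine ⟨n, fun k => S (e.symm k), ⟨fun k => (hS _).isSecondarySub (e.symm k).2, ?_, ?_, ?_⟩,
      e ⟨i, hi⟩, ?_⟩
    · rw [← htop, ← iSup_ne_bot_subtype S]
      exact e.symm.iSup_comp (g := fun i : {i // S i ≠ ⊥} => S i)
    · intro k l hkl
      simp only [(hS _).radical_annihilator_eq (e.symm _).2] at hkl
      exact e.symm.injective (Subtype.ext (hP' _ _ hkl.le))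
    · intro j hj
      obtain ⟨x, hx, hxp⟩ := exists_mem_and_notMem (p := P (e.symm j)) (hp := hP _)
        (P := fun k : {k // k ∈ ({j}ᶜ : Set (Fin n))} => P (e.symm k))
        fun k h => k.2 (e.symm.injective (Subtype.ext (hP' _ _ h)))
      refine (e.symm j).2 (eq_bot_of_surjective_of_nilpotent ((hS _).1 x hxp) ?_)
      obtain ⟨N, hN⟩ := exists_pow_smul_iSup_eq_zero
        (S := fun k : {k // k ∈ ({j}ᶜ : Set (Fin n))} => S (e.symm k))
        fun k => (hS _).2 x (hx k)
      rw [← iSup_subtype''] at hj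
      exact ⟨N, fun m hm => hN m (hj hm)⟩
    · simp [(hS _).radical_annihilator_eq hi]
end

namespace TopLC
variable {R : Type} [CommRing R] {a : Ideal R} {d : ℕ}
  {L M N : Type} [AddCommGroup L] [Module R L] [AddCommGroup M] [Module R M]
  [AddCommGroup N] [Module R N]

lemma map_hom_sum {ι : Type} (s : Finset ι) (f : ι → M →ₗ[R] N) (t : TopLC R a d M) :
    map a d (∑ i ∈ s, f i) t = ∑ i ∈ s, map a d (f i) t := by
  classical
  induction s using Finset.induction_on with
  | empty => simp [map_hom_zero]
  | insert i s hi ih => rw [Finset.sum_insert hi, Finset.sum_insert hi, map_hom_add, ih]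

/-- If finitely many submodules span, their local cohomologies span provided the cohomology
of the direct sum surjects. -/
lemma iSup_range_map_eq_top {ι : Type} [Fintype ι] (K : ι → Submodule R M)
    (h : Function.Surjective (map a d (∑ i, (K i).subtype ∘ₗ LinearMap.proj i :
      (∀ i, K i) →ₗ[R] M))) : ⨆ i, (map a d (K i).subtype).range = ⊤ := by
  refine eq_top_iff.2 fun t _ => ?_
  obtain ⟨s, rfl⟩ := h t
  rw [map_hom_sum]
  refine Submodule.sum_mem _ fun i _ => Submodule.mem_iSup_of_mem i ?_
  rw [map_comp]
  exact LinearMap.mem_range_self _ _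

variable [IsNoetherianRing R]

/-- The top local cohomology functor turns maps with small cokernel into surjections. -/
lemma surjective_map_of_dimLT [Module.Finite R L] [Module.Finite R M] (hL : DimLT R (d + 1) L)
    (f : L →ₗ[R] M) (hf : DimLT R d (M ⧸ f.range)) : Function.Surjective (map a d f) := by
  have := (hL.of_injective f.ker.subtype f.ker.injective_subtype).subsingleton_topLC a
  have := hf.subsingleton_topLC a
  have h1 := surjective_of_vanishing (a := a) (i := d) f.ker.injective_subtype
    (g := f.rangeRestrict) (by rw [LinearMap.exact_iff]; simp) f.surjective_rangeRestrict
  have h2 := exact_middle (a := a) (i := d) f.range.injective_subtype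
    (LinearMap.exact_subtype_mkQ f.range) (Submodule.mkQ_surjective _)
  intro t
  obtain ⟨s, rfl⟩ := (h2 t).1 (Subsingleton.elim _ _)
  obtain ⟨u, rfl⟩ := h1 s
  exact ⟨u, by rw [← map_comp]; rfl⟩

lemma isSecOrBot_range [Module.Finite R N] (hN : DimLT R (d + 1) N) {p : Ideal R} [p.IsPrime]
    (hd : ringKrullDim (R ⧸ p) < (d + 1 : ℕ)) (hp : powTorsion p N = ⊤) (f : N →ₗ[R] M) :
    IsSecOrBot p (map a d f).range := by
  rw [← Submodule.map_top]
  obtain ⟨n, hn⟩ := exists_pow_le_annihilator hp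
  refine IsSecOrBot.map ⟨fun x hx m _ => ?_, fun x hx => ⟨n, fun t _ =>
    smul_eq_zero_of_forall (hn _ (Ideal.pow_mem_pow hx n)) t⟩⟩ _
  obtain ⟨s, hs⟩ := surjective_map_of_dimLT (a := a) hN (x • LinearMap.id) (fun q hq => by
    obtain ⟨h1, h2⟩ := mem_support_smul_coker hq
    have h3 : p ^ n ≤ q.asIdeal := fun r hr =>
      Module.annihilator_le_of_mem_support h1 (Module.mem_annihilator.2 (hn r hr))
    exact ringKrullDim_quotient_lt_of_lt
      (lt_of_le_of_ne (Ideal.IsPrime.le_of_pow_le h3) fun h => hx (h ▸ h2)) hd) m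
  exact ⟨s, Submodule.mem_top, by rw [← hs, map_smul_id]⟩

lemma subsingleton_of_subsingleton_quotient [Module.Finite R N] {p : Ideal R} [p.IsPrime]
    (hd : ringKrullDim (R ⧸ p) < (d + 1 : ℕ)) (hp : ∀ q ∈ Module.support R N, p ≤ q.asIdeal)
    [Subsingleton (TopLC R a d (R ⧸ p))] : Subsingleton (TopLC R a d N) := by
  revert hp
  refine IsNoetherianRing.induction_on_isQuotientEquivQuotientPrime R (M := N) inferInstance
    (motive := fun N _ _ _ => (∀ q ∈ Module.support R N, p ≤ q.asIdeal) →
      Subsingleton (TopLC R a d N)) ?_ ?_ ?_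
  · intro N _ _ _ _ _
    exact subsingleton_of_subsingleton
  · intro N _ _ _ q e h
    suffices Subsingleton (TopLC R a d (R ⧸ q.asIdeal)) from subsingleton_of_equiv e
    have hpq : p ≤ q.asIdeal := h q (e.support_eq ▸ mem_support_quotient_iff.2 le_rfl)
    by_cases h' : p = q.asIdeal
    · rwa [← h']
    · exact (dimLT_quotient_iff.2 (ringKrullDim_quotient_lt_of_lt
        (lt_of_le_of_ne hpq h') hd)).subsingleton_topLC a
  · intro N₁ _ _ _ N₂ _ _ _ N₃ _ _ _ f g hf hg hfg h₁ h₃ h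
    have := h₁ fun q hq => h q (Module.support_subset_of_injective f hf hq)
    have := h₃ fun q hq => h q (Module.support_subset_of_surjective g hg hq)
    refine subsingleton_of_forall_eq 0 fun t => ?_
    obtain ⟨s, rfl⟩ := (exact_middle (a := a) (i := d) hf hfg hg t).1 (Subsingleton.elim _ _)
    rw [Subsingleton.elim s 0, map_zero]

end TopLC

section
variable {R : Type} [CommRing R] {M : Type} [AddCommGroup M] [Module R M] {d : ℕ}

lemma exists_pow_mul_mem_of_mem_minimalPrimes [IsNoetherianRing R] {I p : Ideal R}
    (hp : p ∈ I.minimalPrimes) :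
    ∃ s ∉ p, ∃ n : ℕ, ∀ r ∈ p ^ n, s * r ∈ I := by
  have := hp.1.1
  have := (I.finite_minimalPrimes_of_isNoetherianRing R).subset
    (Set.sdiff_subset (t := {p})) |>.to_subtype
  obtain ⟨s, hs, hsp⟩ := exists_mem_and_notMem
    (P := fun q : (I.minimalPrimes \ {p} : Set (Ideal R)) => q.1) (p := p)
    fun q hq => q.2.2 (hq.antisymm (hp.2 q.2.1.1 hq))
  obtain ⟨n, hn⟩ := I.exists_radical_pow_le_of_fg (IsNoetherian.noetherian _)
  have h1 : Ideal.span {s} * p ≤ I.radical := by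
    rw [← I.sInf_minimalPrimes]
    refine le_sInf fun q hq => ?_
    by_cases hqp : q = p
    · exact hqp ▸ Ideal.mul_le_right
    · exact Ideal.mul_le_left.trans ((Ideal.span_singleton_le_iff_mem _).2 (hs ⟨q, hq, hqp⟩))
  refine ⟨s ^ n, fun h => hsp (Ideal.IsPrime.mem_of_pow_mem ‹_› n h), n, fun r hr => hn ?_⟩
  refine Ideal.pow_right_mono h1 n ?_
  rw [mul_pow]
  exact Ideal.mul_mem_mul (Ideal.pow_mem_pow (Ideal.mem_span_singleton_self s) n) hr

lemma mem_minimalPrimes_annihilator [Module.Finite R M] (hM : DimLT R (d + 1) M)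
    {p : PrimeSpectrum R}
    (hp : p ∈ Module.support R M) (hd : ringKrullDim (R ⧸ p.asIdeal) = d) :
    p.asIdeal ∈ (Module.annihilator R M).minimalPrimes := by
  refine ⟨⟨p.2, Module.annihilator_le_of_mem_support hp⟩, fun q hq hqp => ?_⟩
  by_contra h
  have := hq.1
  have h1 : (⟨q, hq.1⟩ : PrimeSpectrum R) ∈ Module.support R M :=
    Module.mem_support_iff_of_finite.2 hq.2
  have h2 := ringKrullDim_quotient_lt_of_lt (n := d) (lt_of_le_not_ge hqp h) (hM ⟨q, hq.1⟩ h1)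
  exact h2.ne hd

/-- A module in the support admits a nonzero map to the corresponding quotient domain. -/
lemma exists_hom_ne_zero [Module.Finite R M] {p : PrimeSpectrum R} (hp : p ∈ Module.support R M) :
    ∃ f : M →ₗ[R] R ⧸ p.asIdeal, f ≠ 0 := by
  let K := p.asIdeal.ResidueField
  have := (Module.mem_support_iff_nontrivial_residueField_tensorProduct p).1 hp
  obtain ⟨v, hv⟩ := exists_ne (0 : K ⊗[R] M)
  obtain ⟨l, hl⟩ := not_forall.1 (mt (Module.forall_dual_apply_eq_zero_iff K v).1 hv)
  let g : M →ₗ[R] K := l.restrictScalars R ∘ₗ TensorProduct.mk R K M 1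
  obtain ⟨m, hm⟩ : ∃ m, g m ≠ 0 := by
    by_contra! hcon
    refine hl (congrArg (fun f => f v) (show l = 0 from ?_))
    refine TensorProduct.AlgebraTensorModule.curry_injective (LinearMap.ext_ring (LinearMap.ext hcon))
  obtain ⟨s, hs⟩ := Module.Finite.fg_top (R := R) (M := M)
  classical
  obtain ⟨b, hb⟩ := IsLocalization.exist_integer_multiples_of_finset
    (nonZeroDivisors (R ⧸ p.asIdeal)) (s.image g)
  let ι : (R ⧸ p.asIdeal) →ₗ[R] K := (IsScalarTower.toAlgHom R (R ⧸ p.asIdeal) K).toLinearMap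
  have hι : Function.Injective ι := IsFractionRing.injective (R ⧸ p.asIdeal) K
  let b' : K := algebraMap (R ⧸ p.asIdeal) K b
  have hb' : b' ≠ 0 := (map_ne_zero_iff _ hι).2 (nonZeroDivisors.ne_zero b.2)
  let g' : M →ₗ[R] K := LinearMap.mulLeft R b' ∘ₗ g
  have hg' : ∀ m, g' m ∈ ι.range := by
    have : Submodule.span R (s : Set M) ≤ ι.range.comap g' := Submodule.span_le.2 fun x hx => by
      obtain ⟨c, hc⟩ := hb (g x) (Finset.mem_image_of_mem g hx)
      exact ⟨c, hc.trans (Algebra.smul_def _ _)⟩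
    exact fun m => this (hs ▸ Submodule.mem_top)
  refine ⟨(LinearEquiv.ofInjective ι hι).symm.toLinearMap ∘ₗ g'.codRestrict _ hg', fun h => ?_⟩
  have h1 := DFunLike.congr_fun h m
  have h2 : g'.codRestrict ι.range hg' m = 0 :=
    (LinearEquiv.ofInjective ι hι).symm.map_eq_zero_iff.1 h1
  exact mul_ne_zero hb' hm (congrArg Subtype.val h2)

lemma dimLT_coker_of_ne_zero {p : PrimeSpectrum R} (hd : ringKrullDim (R ⧸ p.asIdeal) < (d + 1 : ℕ))
    {f : M →ₗ[R] R ⧸ p.asIdeal} (hf : f ≠ 0) : DimLT R d ((R ⧸ p.asIdeal) ⧸ f.range) := by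
  obtain ⟨m, hm⟩ := DFunLike.ne_iff.1 hf
  obtain ⟨x, hx⟩ := Ideal.Quotient.mk_surjective (f m)
  have hxp : x ∉ p.asIdeal := fun h => hm (hx ▸ Ideal.Quotient.eq_zero_iff_mem.2 h)
  intro q hq
  have h1 := mem_support_quotient_iff.1
    (Module.support_subset_of_surjective _ (Submodule.mkQ_surjective _) hq)
  have h2 : x ∈ q.asIdeal := Module.annihilator_le_of_mem_support hq
    (Module.mem_annihilator.2 fun y => by
      obtain ⟨y, rfl⟩ := Submodule.mkQ_surjective _ y
      obtain ⟨y, rfl⟩ := Ideal.Quotient.mk_surjective y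
      refine (Submodule.Quotient.mk_eq_zero _).2 ⟨y • m, ?_⟩
      rw [map_smul, ← hx]
      exact congrArg (Ideal.Quotient.mk p.asIdeal) (mul_comm y x))
  exact ringKrullDim_quotient_lt_of_lt (lt_of_le_of_ne h1 fun h => hxp (h ▸ h2)) hd

variable (R M d) in
/-- The primes in the support of `M` whose quotient has dimension `d`. -/
abbrev topPrimes : Set (PrimeSpectrum R) :=
  {p | p ∈ Module.support R M ∧ ringKrullDim (R ⧸ p.asIdeal) = d}

lemma finite_topPrimes [IsNoetherianRing R] [Module.Finite R M] (hM : DimLT R (d + 1) M) :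
    (topPrimes R M d).Finite :=
  Set.Finite.of_injOn (fun _ hp => mem_minimalPrimes_annihilator hM hp.1 hp.2)
    (fun _ _ _ _ h => PrimeSpectrum.ext h)
    (Ideal.finite_minimalPrimes_of_isNoetherianRing R (Module.annihilator R M))

lemma eq_of_le_topPrimes [Module.Finite R M] (hM : DimLT R (d + 1) M) (p q : topPrimes R M d)
    (h : p.1.asIdeal ≤ q.1.asIdeal) : p = q :=
  Subtype.ext (PrimeSpectrum.ext (h.antisymm
    ((mem_minimalPrimes_annihilator hM q.2.1 q.2.2).2
      (mem_minimalPrimes_annihilator hM p.2.1 p.2.2).1 h)))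

lemma dimLT_coker_sum_powTorsion [IsNoetherianRing R] [Module.Finite R M]
    (hM : DimLT R (d + 1) M) [Fintype (topPrimes R M d)] :
    DimLT R d (M ⧸ (∑ p : topPrimes R M d, (powTorsion p.1.asIdeal M).subtype ∘ₗ LinearMap.proj p :
      (∀ p : topPrimes R M d, powTorsion p.1.asIdeal M) →ₗ[R] M).range) := by
  classical
  intro p hp
  have h1 := Module.support_subset_of_surjective _ (Submodule.mkQ_surjective _) hp
  refine lt_of_le_of_ne (ENat.WithBot.lt_add_one_iff.1 (by exact_mod_cast hM p h1)) fun hd => ?_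
  obtain ⟨s, hs, n, hn⟩ := exists_pow_mul_mem_of_mem_minimalPrimes
    (mem_minimalPrimes_annihilator hM h1 hd)
  refine hs (Module.annihilator_le_of_mem_support hp (Module.mem_annihilator.2 fun y => ?_))
  obtain ⟨m, rfl⟩ := Submodule.mkQ_surjective _ y
  have hm : s • m ∈ powTorsion p.asIdeal M := ⟨n, fun r hr => by
    rw [smul_smul, mul_comm, Module.mem_annihilator.1 (hn r hr)]⟩
  refine (Submodule.Quotient.mk_eq_zero _).2 ⟨Pi.single ⟨p, h1, hd⟩ ⟨s • m, hm⟩, ?_⟩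
  rw [LinearMap.sum_apply, Finset.sum_eq_single ⟨p, h1, hd⟩]
  · simp
  · intro q _ hq
    simp [hq]
  · simp

lemma dimLT_pi {ι : Type} [Finite ι] {N : ι → Type} [∀ i, AddCommGroup (N i)]
    [∀ i, Module R (N i)] (h : ∀ i, DimLT R d (N i)) : DimLT R d (∀ i, N i) := by
  intro p hp
  obtain ⟨x, hx⟩ := Module.mem_support_iff_exists_annihilator.1 hp
  by_contra hd
  obtain ⟨r, hr, hrp⟩ := exists_mem_and_notMem (P := fun i => (Submodule.span R {x i}).annihilator)
    (p := p.asIdeal) fun i hi => hd (h i p (Module.mem_support_iff_exists_annihilator.2 ⟨x i, hi⟩))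
  refine hrp (hx ((Submodule.mem_annihilator_span_singleton _ _).2 (funext fun i => ?_)))
  exact (Submodule.mem_annihilator_span_singleton _ _).1 (hr i)

/-- The attached primes of the top local cohomology module. -/
theorem attachedPrimes_topLC [IsNoetherianRing R] [Module.Finite R M] (a : Ideal R)
    (hM : DimLT R (d + 1) M) : AttachedPrimes R (TopLC R a d M) =
      {p | ∃ q : topPrimes R M d, Nontrivial (TopLC R a d (R ⧸ q.1.asIdeal)) ∧ p = q.1.asIdeal} := by
  have := (finite_topPrimes hM).to_subtype
  cases nonempty_fintype (topPrimes R M d)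
  have hlt : ∀ p : topPrimes R M d, ringKrullDim (R ⧸ p.1.asIdeal) < (d + 1 : ℕ) := fun p =>
    hM _ p.2.1
  have htors : ∀ p : Ideal R, powTorsion p (powTorsion p M) = ⊤ := fun p => eq_top_iff.2 (by
    rintro ⟨_, n, hn⟩ -
    exact ⟨n, fun r hr => Subtype.ext (hn r hr)⟩)
  have hN : ∀ p : Ideal R, DimLT R (d + 1) (powTorsion p M) := fun p =>
    hM.of_injective _ (Submodule.injective_subtype _)
  let S : topPrimes R M d → Submodule R (TopLC R a d M) := fun p =>
    (TopLC.map a d (powTorsion p.1.asIdeal M).subtype).range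
  have hS : ∀ p, IsSecOrBot p.1.asIdeal (S p) := fun p =>
    TopLC.isSecOrBot_range (hN _) (hlt p) (htors _) _
  have htop : ⨆ p, S p = ⊤ := TopLC.iSup_range_map_eq_top _
    (TopLC.surjective_map_of_dimLT (dimLT_pi fun _ => hN _) _ (dimLT_coker_sum_powTorsion hM))
  rw [attachedPrimes_eq (fun p => p.1.2) (eq_of_le_topPrimes hM) hS htop]
  have key : ∀ p, S p ≠ ⊥ ↔ Nontrivial (TopLC R a d (R ⧸ p.1.asIdeal)) := by
    intro p
    rw [← not_subsingleton_iff_nontrivial, not_iff_not]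
    constructor
    · intro hp
      obtain ⟨f, hf⟩ := exists_hom_ne_zero p.2.1
      have h1 := TopLC.surjective_map_of_dimLT (a := a) hM f (dimLT_coker_of_ne_zero (hlt p) hf)
      have h2 : ∀ q, S q ≤ (TopLC.map a d f).ker := by
        intro q
        by_cases hqp : p = q
        · rw [← hqp, hp]
          exact bot_le
        · obtain ⟨x, hx, hxq⟩ := SetLike.not_le_iff_exists.1 (mt (eq_of_le_topPrimes hM p q) hqp)
          intro t ht
          obtain ⟨s, -, rfl⟩ := (hS q).1 x hxq t ht
          rw [LinearMap.mem_ker, map_smul]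
          refine TopLC.smul_eq_zero_of_forall (fun y => ?_) _
          obtain ⟨y, rfl⟩ := Ideal.Quotient.mk_surjective y
          exact Ideal.Quotient.eq_zero_iff_mem.2 (p.1.asIdeal.mul_mem_right y hx)
      refine subsingleton_of_forall_eq 0 fun t => ?_
      obtain ⟨s, rfl⟩ := h1 t
      exact iSup_le h2 (htop ▸ Submodule.mem_top)
    · intro hp
      obtain ⟨n, hn⟩ := exists_pow_le_annihilator (htors p.1.asIdeal)
      have := TopLC.subsingleton_of_subsingleton_quotient (a := a)
        (N := powTorsion p.1.asIdeal M) (hlt p) fun q hq =>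
          Ideal.IsPrime.le_of_pow_le (n := n) fun r hr =>
            Module.annihilator_le_of_mem_support hq (Module.mem_annihilator.2 (hn r hr))
      refine (Submodule.eq_bot_iff _).2 ?_
      rintro _ ⟨t, rfl⟩
      rw [Subsingleton.elim t 0, map_zero]
  simp only [key]

lemma dimLT_succ_of_moduleDim_eq (h : moduleDim R M = d) : DimLT R (d + 1) M := by
  intro p hp
  rw [ringKrullDim_quotient]
  have h1 : PrimeSpectrum.zeroLocus (p.asIdeal : Set R) ⊆ Module.support R M := fun q hq =>
    Module.mem_support_mono hq hp
  have h2 : Order.krullDim (PrimeSpectrum.zeroLocus (p.asIdeal : Set R)) ≤ d :=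
    (Order.krullDim_le_of_strictMono (Set.inclusion h1) fun _ _ => id).trans_eq h
  exact h2.trans_lt (by exact_mod_cast Nat.lt_succ_self d)

lemma mem_assh_iff [IsNoetherianRing R] [Module.Finite R M] (h : moduleDim R M = d) {p : Ideal R} :
    p ∈ Assh R M ↔ ∃ q : topPrimes R M d, p = q.1.asIdeal := by
  constructor
  · rintro ⟨h1, h2⟩
    have := h1.isPrime
    exact ⟨⟨⟨p, h1.isPrime⟩, by
      rw [Module.mem_support_iff_of_finite]
      exact Submodule.annihilator_top (R := R) (M := M) ▸ IsAssociatedPrime.annihilator_le h1,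
      h2.trans h⟩, rfl⟩
  · rintro ⟨q, rfl⟩
    exact ⟨Module.associatedPrimes.minimalPrimes_annihilator_subset_associatedPrimes R M
      (mem_minimalPrimes_annihilator (dimLT_succ_of_moduleDim_eq h) q.2.1 q.2.2),
      q.2.2.trans h.symm⟩

lemma cohDim_eq_iff [IsNoetherianRing R] [Module.Finite R M] (a : Ideal R)
    (hM : DimLT R (d + 1) M) : cohDim R a M = d ↔ Nontrivial (TopLC R a d M) := by
  have h1 : ∀ i : ℕ, Nontrivial (TopLC R a i M) → i ≤ d := fun i hi => by
    by_contra! hid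
    exact not_subsingleton _ ((hM.mono hid).subsingleton_topLC a)
  constructor
  · intro h
    by_contra hd
    have h2 : ∀ i : ℕ, Nontrivial (TopLC R a i M) → i < d := fun i hi =>
      lt_of_le_of_ne (h1 i hi) fun hid => hd (hid ▸ hi)
    have h3 : cohDim R a M ≤ ((d - 1 : ℕ) : WithBot ℕ∞) := sSup_le (by
      rintro _ ⟨i, rfl, hi⟩
      exact_mod_cast Nat.le_sub_one_of_lt (h2 i hi))
    rw [h] at h3
    have h4 : d ≤ d - 1 := by exact_mod_cast h3
    obtain rfl : d = 0 := by omega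
    have h5 : cohDim R a M ≤ ⊥ := sSup_le (by
      rintro _ ⟨i, rfl, hi⟩
      exact absurd (h2 i hi) i.not_lt_zero)
    exact absurd (h ▸ h5) (by simp)
  · exact fun h => le_antisymm (sSup_le (by
      rintro _ ⟨i, rfl, hi⟩
      exact_mod_cast h1 i hi)) (le_sSup ⟨d, rfl, h⟩)

end

/-- For a finitely generated module `M` of finite dimension `d` over a Noetherian
ring `R` and an ideal `a`, `Att_R H^d_a(M) = { p ∈ Assh_R M : cd_R(a, R/p) = d }`. -/
theorem stmt_5 (R : Type) [CommRing R] [IsNoetherianRing R] (a : Ideal R)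
    (M : Type) [AddCommGroup M] [Module R M] [Module.Finite R M]
    (d : ℕ) (hd : moduleDim R M = (d : WithBot ℕ∞)) :
    AttachedPrimes R (TopLC R a d M) =
      { p | p ∈ Assh R M ∧ cohDim R a (R ⧸ p) = (d : WithBot ℕ∞) } := by
  rw [attachedPrimes_topLC a (dimLT_succ_of_moduleDim_eq hd)]
  ext p
  have h : ∀ q : topPrimes R M d, cohDim R a (R ⧸ q.1.asIdeal) = d ↔
      Nontrivial (TopLC R a d (R ⧸ q.1.asIdeal)) := fun q =>
    cohDim_eq_iff a (dimLT_quotient_iff.2 (dimLT_succ_of_moduleDim_eq hd q.1 q.2.1))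
  simp only [Set.mem_ofPred_eq, mem_assh_iff hd]
  constructor
  · rintro ⟨q, hq, rfl⟩
    exact ⟨⟨q, rfl⟩, (h q).2 hq⟩
  · rintro ⟨⟨q, rfl⟩, hq⟩
    exact ⟨q, (h q).1 hq, rfl⟩
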